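/- Let w be a weight function on ordered pairs of links with values in [0,1] and let c ≥ 1, C₀ ≥ 0 be constants such that: for any three links ℓ=(s,r), ℓ'=(s',r'), ℓ''=(s'',r'') with dist(s',r) ≤ 3·dist(s'',r) and π(ℓ') < π(ℓ''), one has w(ℓ,ℓ'') ≤ c·w(ℓ,ℓ'). Let L be a finite set of links such that L or its reversed set L* is admissible, and such that Σ_{ℓ'∈L} w(ℓ',ℓ) ≤ C₀ for every ℓ ∈ L. Then for every link ℓ ∈ R: Σ_{ℓ'∈L, π(ℓ') < π(ℓ)} w(ℓ',ℓ) ≤ (9^α + 1) + c·C₀. -/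

import Mathlib

open Finset

noncomputable def sinr {X : Type*} {ι : Type*} [MetricSpace X] [DecidableEq ι]
    (α N : ℝ) (s r : ι → X) (p : ι → ℝ) (L : Finset ι) (i : ι) : ℝ :=
  (p i / dist (s i) (r i) ^ α) /
    ((∑ j ∈ L.erase i, p j / dist (s j) (r i) ^ α) + N)

/-- A set `L` of links is admissible if some nonnegative power assignment gives
every link of `L` an SINR at least its threshold `β`. -/
def Admissible {X : Type*} {ι : Type*} [MetricSpace X] [DecidableEq ι]
    (α N : ℝ) (s r : ι → X) (β : ι → ℝ) (L : Finset ι) : Prop :=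
  ∃ p : ι → ℝ, (∀ i ∈ L, 0 ≤ p i) ∧ ∀ i ∈ L, β i ≤ sinr α N s r p L i

lemma card_aux {ι : Type*} [DecidableEq ι] (B : Finset ι) (q : ι → ℝ) (K : ℝ) (hK : 0 ≤ K)
    (hq : ∀ j ∈ B, 0 < q j) (h : ∀ j ∈ B, ∑ k ∈ B.erase j, q k ≤ K * q j) :
    (B.card : ℝ) ≤ K + 1 := by
  rcases B.eq_empty_or_nonempty with rfl | hne
  · simp; linarith
  have hS : 0 < ∑ k ∈ B, q k := Finset.sum_pos hq hne
  have h1 : ∑ j ∈ B, ∑ k ∈ B, q k ≤ ∑ j ∈ B, (K + 1) * q j := by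
    apply Finset.sum_le_sum
    intro j hj
    have := h j hj
    have h2 := Finset.add_sum_erase B q hj
    linarith
  rw [Finset.sum_const, nsmul_eq_mul, ← Finset.mul_sum] at h1
  exact le_of_mul_le_mul_right h1 hS

lemma sinr_aux {X : Type*} {ι : Type*} [MetricSpace X] [DecidableEq ι]
    (α N : ℝ) (hN : 0 < N) (s r : ι → X) (β : ι → ℝ) (hβ : ∀ i, 1 ≤ β i)
    (L : Finset ι) (p : ι → ℝ) (hp : ∀ i ∈ L, 0 ≤ p i)
    (h : ∀ i ∈ L, β i ≤ sinr α N s r p L i) (B : Finset ι) (hB : B ⊆ L) (j : ι) (hj : j ∈ B) :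
    0 < p j / dist (s j) (r j) ^ α ∧
    ∑ k ∈ B.erase j, p k / dist (s k) (r j) ^ α ≤ p j / dist (s j) (r j) ^ α := by
  have h1 := (hβ j).trans (h j (hB hj))
  unfold sinr at h1
  have hn : ∀ k ∈ L, 0 ≤ p k / dist (s k) (r j) ^ α := fun k hk =>
    div_nonneg (hp k hk) (Real.rpow_nonneg dist_nonneg _)
  have hs : ∑ k ∈ B.erase j, p k / dist (s k) (r j) ^ α
      ≤ ∑ k ∈ L.erase j, p k / dist (s k) (r j) ^ α :=
    Finset.sum_le_sum_of_subset_of_nonneg (Finset.erase_subset_erase _ hB)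
      (fun k hk _ => hn k (Finset.mem_of_mem_erase hk))
  have hs0 : 0 ≤ ∑ k ∈ B.erase j, p k / dist (s k) (r j) ^ α :=
    Finset.sum_nonneg fun k hk => hn k (hB (Finset.mem_of_mem_erase hk))
  rw [one_le_div (by linarith)] at h1
  constructor <;> linarith

lemma card_bad {X : Type*} {ι : Type*} [MetricSpace X] [DecidableEq ι]
    (α N : ℝ) (hα : 1 ≤ α) (hN : 0 < N)
    (s r : ι → X) (β : ι → ℝ) (hβ : ∀ i, 1 ≤ β i)
    (hd : ∀ i, 0 < dist (s i) (r i))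
    (hcross : ∀ i j, i ≠ j → 0 < dist (s i) (r j))
    (L : Finset ι)
    (hadm : Admissible α N s r β L ∨ Admissible α N r s β L)
    (B : Finset ι) (hB : B ⊆ L)
    (h3 : ∀ j ∈ B, ∀ k ∈ B, dist (s j) (r k) ≤ 3 * dist (s j) (r j)) :
    (B.card : ℝ) ≤ 3 ^ α + 1 := by
  have h3p : (0:ℝ) < 3 ^ α := Real.rpow_pos_of_pos (by norm_num) _
  have hdp : ∀ j, 0 < dist (s j) (r j) ^ α := fun j => Real.rpow_pos_of_pos (hd j) _
  have hle : ∀ j ∈ B, ∀ k ∈ B, dist (s j) (r k) ^ α ≤ 3 ^ α * dist (s j) (r j) ^ α := by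
    intro j hj k hk
    rw [← Real.mul_rpow (by norm_num) dist_nonneg]
    exact Real.rpow_le_rpow dist_nonneg (h3 j hj k hk) (by linarith)
  rcases hadm with ⟨p, hp, h⟩ | ⟨p, hp, h⟩
  · apply card_aux B (fun j => p j / dist (s j) (r j) ^ α) _ h3p.le
    · intro j hj
      exact (sinr_aux α N hN s r β hβ L p hp h B hB j hj).1
    · intro j hj
      refine le_trans ?_ (mul_le_mul_of_nonneg_left
        (sinr_aux α N hN s r β hβ L p hp h B hB j hj).2 h3p.le)
      rw [Finset.mul_sum]
      apply Finset.sum_le_sum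
      intro k hk
      have hkB := Finset.mem_of_mem_erase hk
      have hx : 0 < dist (s k) (r j) ^ α :=
        Real.rpow_pos_of_pos (hcross k j (Finset.ne_of_mem_erase hk)) _
      have hpk := hp k (hB hkB)
      rw [← mul_div_assoc, div_le_div_iff₀ (hdp k) hx]
      nlinarith [mul_le_mul_of_nonneg_left (hle k hkB j hj) hpk]
  · have key := sinr_aux α N hN r s β hβ L p hp h B hB
    apply card_aux B p _ h3p.le
    · intro j hj
      have h1 := (key j hj).1
      rw [dist_comm] at h1
      exact (div_pos_iff_of_pos_right (hdp j)).1 h1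
    · intro j hj
      have h1 := (key j hj).2
      rw [dist_comm (r j), le_div_iff₀ (hdp j), Finset.sum_mul] at h1
      refine le_trans ?_ (mul_le_mul_of_nonneg_left h1 h3p.le)
      rw [Finset.mul_sum]
      apply Finset.sum_le_sum
      intro k hk
      have hkB := Finset.mem_of_mem_erase hk
      have hx : 0 < dist (s j) (r k) ^ α :=
        Real.rpow_pos_of_pos (hcross j k (Finset.ne_of_mem_erase hk).symm) _
      have hpk := hp k (hB hkB)
      rw [dist_comm (r k), div_mul_eq_mul_div, ← mul_div_assoc, le_div_iff₀ hx]
      nlinarith [mul_le_mul_of_nonneg_left (hle j hj k hkB) hpk]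

/-- Geometry lemma (receiver version): let `w` be a weight function with values in
`[0,1]` such that `w(ℓ,ℓ'') ≤ c·w(ℓ,ℓ')` whenever `d(s',r) ≤ 3·d(s'',r)` and
`π(ℓ') < π(ℓ'')`. If `L` or its reversed set is admissible and the incoming
weight `Σ_{ℓ'∈L} w(ℓ',ℓ)` is at most `C₀` for every `ℓ ∈ L`, then for every
link `ℓ` of the ground set, `Σ_{ℓ'∈L, π(ℓ')<π(ℓ)} w(ℓ',ℓ) ≤ (9^α+1) + c·C₀`. -/
theorem geometry_lemma_receivers
    {X : Type*} {ι : Type*} [MetricSpace X] [Fintype ι] [DecidableEq ι]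
    (α N : ℝ) (hα : 1 ≤ α) (hN : 0 < N)
    (s r : ι → X) (β : ι → ℝ) (π : ι → ℕ)
    (hβ : ∀ i, 1 ≤ β i)
    (hd : ∀ i, 0 < dist (s i) (r i))
    (hcross : ∀ i j, i ≠ j → 0 < dist (s i) (r j))
    (hπinj : Function.Injective π)
    (hπ : ∀ i j, π i < π j →
      β j * dist (s j) (r j) ^ α ≤ β i * dist (s i) (r i) ^ α)
    (w : ι → ι → ℝ) (hw0 : ∀ i j, 0 ≤ w i j) (hw1 : ∀ i j, w i j ≤ 1)
    (c C₀ : ℝ) (hc : 1 ≤ c) (hC₀ : 0 ≤ C₀)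
    (hcond : ∀ i i' i'' : ι, dist (s i') (r i) ≤ 3 * dist (s i'') (r i) →
      π i' < π i'' → w i i'' ≤ c * w i i')
    (L : Finset ι)
    (hadm : Admissible α N s r β L ∨ Admissible α N r s β L)
    (hin : ∀ i ∈ L, ∑ j ∈ L, w j i ≤ C₀) :
    ∀ i : ι, ∑ j ∈ L.filter (fun j => π j < π i), w j i
      ≤ ((9:ℝ) ^ α + 1) + c * C₀ := by
  intro i
  have h39 : (3:ℝ) ^ α ≤ 9 ^ α := Real.rpow_le_rpow (by norm_num) (by norm_num) (by linarith)
  have h3p : (0:ℝ) < 3 ^ α := Real.rpow_pos_of_pos (by norm_num) _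
  rcases (L.filter (fun j => π j < π i)).eq_empty_or_nonempty with he | hne
  · rw [he, Finset.sum_empty]
    have : 0 ≤ c * C₀ := mul_nonneg (by linarith) hC₀
    linarith
  obtain ⟨m, hm, hmin⟩ := Finset.exists_min_image _ (fun j => dist (s j) (s i)) hne
  set M := L.filter (fun j => π j < π i) with hM
  have hML : M ⊆ L := Finset.filter_subset _ _
  have hmL := hML hm
  have hmi : π m < π i := (Finset.mem_filter.1 hm).2
  rw [← Finset.sum_filter_add_sum_filter_not M
    (fun j => 2 * dist (s i) (r j) < dist (s m) (s i))]
  apply add_le_add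
  · set B := M.filter (fun j => 2 * dist (s i) (r j) < dist (s m) (s i)) with hBdef
    have hcard : (B.card : ℝ) ≤ 3 ^ α + 1 := by
      apply card_bad α N hα hN s r β hβ hd hcross L hadm B
        ((Finset.filter_subset _ _).trans hML)
      intro j hj k hk
      obtain ⟨hjM, hj2⟩ := Finset.mem_filter.1 hj
      obtain ⟨hkM, hk2⟩ := Finset.mem_filter.1 hk
      have hmj : dist (s m) (s i) ≤ dist (s j) (s i) := hmin j hjM
      have t1 := dist_triangle (s j) (r j) (s i)
      have t2 := dist_triangle (s j) (s i) (r k)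
      rw [dist_comm (r j)] at t1
      linarith
    calc ∑ j ∈ B, w j i ≤ ∑ j ∈ B, (1:ℝ) := Finset.sum_le_sum fun j _ => hw1 j i
      _ = B.card := by simp
      _ ≤ _ := by linarith
  · calc _ ≤ ∑ j ∈ M.filter (fun j => ¬ 2 * dist (s i) (r j) < dist (s m) (s i)), c * w j m := by
          apply Finset.sum_le_sum
          intro j hj
          have hj2 := (Finset.mem_filter.1 hj).2
          have t := dist_triangle (s m) (s i) (r j)
          exact hcond j m i (by linarith) hmi
      _ ≤ ∑ j ∈ L, c * w j m :=
          Finset.sum_le_sum_of_subset_of_nonneg ((Finset.filter_subset _ _).trans hML)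
            (fun j _ _ => mul_nonneg (by linarith) (hw0 j m))
      _ = c * ∑ j ∈ L, w j m := by rw [Finset.mul_sum]
      _ ≤ c * C₀ := mul_le_mul_of_nonneg_left (hin m hmL) (by linarith)
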